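/- arXiv:math/0610261 — 4 statements merged into one kernel-verified Lean document; each statement's English description precedes it below -/
import Mathlib

section
/- Let A = {a_1, a_2, a_3} be a set of three distinct exceptional classes. Then it is NOT the case that ⟨a_1,a_2⟩ = ⟨a_1,a_3⟩ = ⟨a_2,a_3⟩ = 1 (i.e. the three classes do not form a triangle in the graph of (−1)-curves) if and only if there exist exceptional classes c_1,…,c_6 (pairwise distinct) and h_2,…,h_6 (pairwise distinct), none of which belongs to A, such that: (1) ⟨h_i,h_j⟩ = 0 for all i ≠ j; (2) for each i ∈ {2,…,6}, ⟨h_i,c_i⟩ = 1 and ⟨h_i,c_1⟩ = 1, while ⟨h_i,c_j⟩ = 0 for every j ∉ {1,i}; (3) there is a conic class D such that the set of unordered pairs {a,b} of distinct exceptional classes with a + b = D is exactly {{c_i, h_i} : i = 2,…,6}. -/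
open MvPolynomial

/-- The Picard lattice `ℤ^7` of a degree-3 Del Pezzo surface, with basis `ℓ, ε_1, …, ε_6`
(coordinate `0` is the `ℓ`-coordinate). -/
abbrev Pic7 := Fin 7 → ℤ

/-- The intersection form: `⟨ℓ,ℓ⟩ = 1`, `⟨ε_i,ε_j⟩ = -δ_ij`, `⟨ℓ,ε_i⟩ = 0`. -/
def ip (u v : Pic7) : ℤ := u 0 * v 0 - ∑ i : Fin 6, u i.succ * v i.succ

/-- The class `ℓ`. -/
def lv : Pic7 := fun j => if j = 0 then 1 else 0

/-- The class `ε_i`. -/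
def ev (i : Fin 6) : Pic7 := fun j => if j = i.succ then 1 else 0

/-- The canonical class `K = -3ℓ + ε_1 + … + ε_6`. -/
def Kcl : Pic7 := fun j => if j = 0 then -3 else 1

/-- An exceptional class: `⟨v,v⟩ = -1` and `⟨K,v⟩ = -1`. -/
def IsExc (v : Pic7) : Prop := ip v v = -1 ∧ ip Kcl v = -1

/-- A conic class: `⟨v,v⟩ = 0` and `⟨K,v⟩ = -2`. -/
def IsConic (v : Pic7) : Prop := ip v v = 0 ∧ ip Kcl v = -2

/-- The 27 exceptional classes. -/
def LL : Fin 27 → Pic7 :=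
  ![
    ![0, 1, 0, 0, 0, 0, 0], ![0, 0, 1, 0, 0, 0, 0], ![0, 0, 0, 1, 0, 0, 0],
    ![0, 0, 0, 0, 1, 0, 0], ![0, 0, 0, 0, 0, 1, 0], ![0, 0, 0, 0, 0, 0, 1],
    ![2, 0, -1, -1, -1, -1, -1], ![2, -1, 0, -1, -1, -1, -1], ![2, -1, -1, 0, -1, -1, -1],
    ![2, -1, -1, -1, 0, -1, -1], ![2, -1, -1, -1, -1, 0, -1], ![2, -1, -1, -1, -1, -1, 0],
    ![1, -1, -1, 0, 0, 0, 0], ![1, -1, 0, -1, 0, 0, 0], ![1, -1, 0, 0, -1, 0, 0],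
    ![1, -1, 0, 0, 0, -1, 0], ![1, -1, 0, 0, 0, 0, -1], ![1, 0, -1, -1, 0, 0, 0],
    ![1, 0, -1, 0, -1, 0, 0], ![1, 0, -1, 0, 0, -1, 0], ![1, 0, -1, 0, 0, 0, -1],
    ![1, 0, 0, -1, -1, 0, 0], ![1, 0, 0, -1, 0, -1, 0], ![1, 0, 0, -1, 0, 0, -1],
    ![1, 0, 0, 0, -1, -1, 0], ![1, 0, 0, 0, -1, 0, -1], ![1, 0, 0, 0, 0, -1, -1]]

/-- The intersection graph, packed row by row into one number. -/
def BIG : ℕ := 53067618229521769046738071573877416778872586263338265013355549100346230972124408789241793385084288113576990963260684376741750278034318370957010413230707409486494262579936661591203694540791800365035368156551509140701056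

def TT (i j : Fin 27) : Bool := BIG.testBit (27 * i.val + j.val)

/-- The row of a line, together with the line itself. -/
def WW (i : Fin 27) : ℕ := (BIG >>> (27 * i.val)) ||| 2 ^ i.val

def HH : Fin 27 → Fin 5 → Fin 27 :=
  ![
    ![7, 8, 9, 10, 11], ![6, 8, 9, 10, 11], ![6, 7, 9, 10, 11], ![6, 7, 8, 10, 11],
    ![6, 7, 8, 9, 11], ![6, 7, 8, 9, 10], ![1, 2, 3, 4, 5], ![0, 2, 3, 4, 5],
    ![0, 1, 3, 4, 5], ![0, 1, 2, 4, 5], ![0, 1, 2, 3, 5], ![0, 1, 2, 3, 4],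
    ![0, 1, 21, 22, 23], ![0, 2, 18, 19, 20], ![0, 3, 17, 19, 20], ![0, 4, 17, 18, 20],
    ![0, 5, 17, 18, 19], ![1, 2, 14, 15, 16], ![1, 3, 13, 15, 16], ![1, 4, 13, 14, 16],
    ![1, 5, 13, 14, 15], ![2, 3, 12, 15, 16], ![2, 4, 12, 14, 16], ![2, 5, 12, 14, 15],
    ![3, 4, 12, 13, 16], ![3, 5, 12, 13, 15], ![4, 5, 12, 13, 14]]

def CC : Fin 27 → Fin 6 → Fin 27 :=
  ![
    ![0, 12, 13, 14, 15, 16], ![1, 12, 17, 18, 19, 20], ![2, 13, 17, 21, 22, 23], ![3, 14, 18, 21, 24, 25],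
    ![4, 15, 19, 22, 24, 26], ![5, 16, 20, 23, 25, 26], ![6, 12, 13, 14, 15, 16], ![7, 12, 17, 18, 19, 20],
    ![8, 13, 17, 21, 22, 23], ![9, 14, 18, 21, 24, 25], ![10, 15, 19, 22, 24, 26], ![11, 16, 20, 23, 25, 26],
    ![12, 7, 6, 26, 25, 24], ![13, 8, 6, 26, 25, 24], ![14, 9, 6, 26, 23, 22], ![15, 10, 6, 25, 23, 21],
    ![16, 11, 6, 24, 22, 21], ![17, 8, 7, 26, 25, 24], ![18, 9, 7, 26, 23, 22], ![19, 10, 7, 25, 23, 21],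
    ![20, 11, 7, 24, 22, 21], ![21, 9, 8, 26, 20, 19], ![22, 10, 8, 25, 20, 18], ![23, 11, 8, 24, 19, 18],
    ![24, 10, 9, 23, 20, 17], ![25, 11, 9, 22, 19, 17], ![26, 11, 10, 21, 18, 17]]

theorem ip_exp (u v : Pic7) : ip u v = u 0 * v 0 - (u 1 * v 1 + u 2 * v 2 + u 3 * v 3 + u 4 * v 4
    + u 5 * v 5 + u 6 * v 6) := by
  simp only [ip, Fin.sum_univ_six]
  rfl

theorem ipK (v : Pic7) : ip Kcl v = -3 * v 0 - (v 1 + v 2 + v 3 + v 4 + v 5 + v 6) := by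
  rw [ip_exp]; simp [Kcl]

instance (v : Pic7) : Decidable (IsExc v) := by unfold IsExc; infer_instance

theorem LL_exc : ∀ i, IsExc (LL i) := by decide +kernel

theorem LL_inj : ∀ i j, LL i = LL j → i = j := by decide +kernel

theorem TT_iff : ∀ i j, ip (LL i) (LL j) = 1 ↔ TT i j = true := by decide +kernel

theorem enum0 : ∀ b₁ ∈ ({0, 1} : Finset ℤ), ∀ b₂ ∈ ({0, 1} : Finset ℤ), ∀ b₃ ∈ ({0, 1} : Finset ℤ),
    ∀ b₄ ∈ ({0, 1} : Finset ℤ), ∀ b₅ ∈ ({0, 1} : Finset ℤ), ∀ b₆ ∈ ({0, 1} : Finset ℤ),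
    b₁ + b₂ + b₃ + b₄ + b₅ + b₆ = 1 → ∃ i, LL i = ![0, b₁, b₂, b₃, b₄, b₅, b₆] := by
  decide +kernel

theorem enum1 : ∀ a ∈ ({1, 2} : Finset ℤ),
    ∀ b₁ ∈ ({0, -1} : Finset ℤ), ∀ b₂ ∈ ({0, -1} : Finset ℤ), ∀ b₃ ∈ ({0, -1} : Finset ℤ),
    ∀ b₄ ∈ ({0, -1} : Finset ℤ), ∀ b₅ ∈ ({0, -1} : Finset ℤ), ∀ b₆ ∈ ({0, -1} : Finset ℤ),
    b₁ + b₂ + b₃ + b₄ + b₅ + b₆ = 1 - 3 * a → ∃ i, LL i = ![a, b₁, b₂, b₃, b₄, b₅, b₆] := by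
  decide +kernel

theorem int_ineq (b : ℤ) : 0 ≤ b * (b + 1) := by
  rcases le_or_gt 0 b with h | h <;> nlinarith

theorem int_ineq' (b : ℤ) : 0 ≤ b * (b - 1) := by
  rcases le_or_gt b 0 with h | h <;> nlinarith

theorem exc_enum (v : Pic7) (hv : IsExc v) : ∃ i, v = LL i := by
  obtain ⟨h1, h2⟩ := hv
  rw [ipK] at h2
  rw [ip_exp] at h1
  have hvv : v = ![v 0, v 1, v 2, v 3, v 4, v 5, v 6] := by
    ext i; fin_cases i <;> rfl
  generalize v 0 = a, v 1 = b₁, v 2 = b₂, v 3 = b₃, v 4 = b₄, v 5 = b₅, v 6 = b₆ at *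
  have hs : b₁ + b₂ + b₃ + b₄ + b₅ + b₆ = 1 - 3 * a := by linarith
  have hc : (1 - 3 * a) ^ 2 ≤ 6 * (a * a + 1) := by
    have : (b₁ + b₂ + b₃ + b₄ + b₅ + b₆) ^ 2 ≤
        6 * (b₁ * b₁ + b₂ * b₂ + b₃ * b₃ + b₄ * b₄ + b₅ * b₅ + b₆ * b₆) := by
      nlinarith [sq_nonneg (b₁ - b₂), sq_nonneg (b₁ - b₃), sq_nonneg (b₁ - b₄),
        sq_nonneg (b₁ - b₅), sq_nonneg (b₁ - b₆), sq_nonneg (b₂ - b₃), sq_nonneg (b₂ - b₄),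
        sq_nonneg (b₂ - b₅), sq_nonneg (b₂ - b₆), sq_nonneg (b₃ - b₄), sq_nonneg (b₃ - b₅),
        sq_nonneg (b₃ - b₆), sq_nonneg (b₄ - b₅), sq_nonneg (b₄ - b₆), sq_nonneg (b₅ - b₆)]
    rw [hs] at this
    linarith
  have ha0 : 0 ≤ a := by by_contra h; nlinarith
  have ha2 : a ≤ 2 := by by_contra h; nlinarith
  have key : ∀ b : ℤ, b * (b + 1) = 0 → b ∈ ({0, -1} : Finset ℤ) := by
    intro b hb
    rcases mul_eq_zero.1 hb with h | h
    · simp [h]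
    · have : b = -1 := by linarith
      simp [this]
  have key' : ∀ b : ℤ, b * (b - 1) = 0 → b ∈ ({0, 1} : Finset ℤ) := by
    intro b hb
    rcases mul_eq_zero.1 hb with h | h
    · simp [h]
    · have : b = 1 := by linarith
      simp [this]
  rw [hvv]
  clear hvv
  have e1 := int_ineq b₁
  have e2 := int_ineq b₂
  have e3 := int_ineq b₃
  have e4 := int_ineq b₄
  have e5 := int_ineq b₅
  have e6 := int_ineq b₆
  have f1 := int_ineq' b₁
  have f2 := int_ineq' b₂
  have f3 := int_ineq' b₃
  have f4 := int_ineq' b₄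
  have f5 := int_ineq' b₅
  have f6 := int_ineq' b₆
  have hcase : a = 0 ∨ a ∈ ({1, 2} : Finset ℤ) := by
    simp only [Finset.mem_insert, Finset.mem_singleton]; omega
  rcases hcase with h | h
  · subst h
    obtain ⟨i, hi⟩ := enum0 b₁ (key' _ (by linarith)) b₂ (key' _ (by linarith))
      b₃ (key' _ (by linarith)) b₄ (key' _ (by linarith)) b₅ (key' _ (by linarith))
      b₆ (key' _ (by linarith)) (by linarith)
    exact ⟨i, hi.symm⟩
  · have hq : a * a - 3 * a + 2 = 0 := by
      simp only [Finset.mem_insert, Finset.mem_singleton] at h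
      rcases h with h | h <;> subst h <;> norm_num
    obtain ⟨i, hi⟩ := enum1 a h b₁ (key _ (by linarith)) b₂ (key _ (by linarith))
      b₃ (key _ (by linarith)) b₄ (key _ (by linarith)) b₅ (key _ (by linarith))
      b₆ (key _ (by linarith)) (by linarith)
    exact ⟨i, hi.symm⟩

theorem triple_mask : ∀ i j k : Fin 27, (TT i j && TT i k && TT j k) = true ∨
    ((WW i ||| WW j ||| WW k) % 2 ^ 27 == 2 ^ 27 - 1) = false := by
  decide +kernel

theorem TT_symm : ∀ i j, TT i j = TT j i := by decide +kernel

theorem WW_bit (i e : Fin 27) (h : e = i ∨ TT e i = true) : (WW i).testBit e.val = true := by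
  unfold WW
  rw [Nat.testBit_or, Nat.testBit_shiftRight, Bool.or_eq_true]
  rcases h with h | h
  · right; rw [h]; exact Nat.testBit_two_pow_self
  · left; rw [TT_symm] at h; exact h

theorem triple (i j k : Fin 27) (h : (TT i j && TT i k && TT j k) = false) :
    ∃ e : Fin 27, (TT e i || TT e j || TT e k) = false ∧ e ≠ i ∧ e ≠ j ∧ e ≠ k := by
  by_contra hc
  push Not at hc
  rcases triple_mask i j k with hm | hm
  · rw [h] at hm; exact absurd hm (by decide)
  · rw [beq_eq_false_iff_ne] at hm
    apply hm
    apply Nat.eq_of_testBit_eq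
    intro n
    rw [Nat.testBit_mod_two_pow, Nat.testBit_two_pow_sub_one]
    by_cases hn : n < 27
    · have hb : (WW i ||| WW j ||| WW k).testBit n = true := by
        have h0 := hc ⟨n, hn⟩
        have hi := WW_bit i ⟨n, hn⟩
        have hj := WW_bit j ⟨n, hn⟩
        have hk := WW_bit k ⟨n, hn⟩
        rw [Nat.testBit_or, Nat.testBit_or, Bool.or_eq_true, Bool.or_eq_true]
        simp only [← Bool.not_eq_true, Bool.or_eq_true] at h0
        simp only at hi hj hk
        tauto
      rw [hb]; simp
    · simp [hn]

theorem triangle : ∀ i j : Fin 27, TT i j = true → ∀ k, TT i k = true → TT j k = true →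
    ∀ e : Fin 27, (TT e i || TT e j || TT e k) = true := by
  decide +kernel

theorem CC_zero : ∀ e, CC e 0 = e := by decide +kernel
theorem CC_inj : ∀ e i j, CC e i = CC e j → i = j := by decide +kernel
theorem HH_inj : ∀ e i j, HH e i = HH e j → i = j := by decide +kernel
theorem CC_T : ∀ e (i : Fin 5), TT e (CC e i.succ) = true := by decide +kernel
theorem HH_T : ∀ e (i : Fin 5), TT e (HH e i) = true := by decide +kernel
theorem HH_orth : ∀ e i j, i ≠ j → ip (LL (HH e i)) (LL (HH e j)) = 0 := by decide +kernel
theorem HC : ∀ e (i : Fin 5), ip (LL (HH e i)) (LL (CC e i.succ)) = 1 ∧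
    ip (LL (HH e i)) (LL (CC e 0)) = 1 ∧
    ∀ j : Fin 6, j ≠ 0 → j ≠ i.succ → ip (LL (HH e i)) (LL (CC e j)) = 0 := by decide +kernel
theorem HC_sum : ∀ e (i : Fin 5), LL (CC e i.succ) + LL (HH e i) = -Kcl - LL e := by decide +kernel
theorem D_conic : ∀ e, ip (-Kcl - LL e) (-Kcl - LL e) = 0 ∧ ip Kcl (-Kcl - LL e) = -2 := by
  decide +kernel
theorem D_fib : ∀ e x, IsExc (-Kcl - LL e - LL x) →
    ∃ i : Fin 5, x = CC e i.succ ∨ x = HH e i := by decide +kernel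

/-- Three distinct exceptional classes `a₁, a₂, a₃` do NOT form a triangle in
the graph of `(−1)`-curves if and only if there are exceptional classes `c_1,…,c_6` and
`h_2,…,h_6` (pairwise distinct, none in `{a₁,a₂,a₃}`) such that the `h_i` are pairwise
orthogonal, `h_i` meets exactly `c_i` and `c_1` among the `c_j`, and there is a conic class `D`
whose unordered pairs of distinct exceptional classes summing to `D` are exactly the
`{c_i, h_i}`, `i = 2,…,6`.
(Here `c : Fin 6 → Pic7` lists `c_1,…,c_6` with `c 0 = c_1`, and `h : Fin 5 → Pic7` lists
`h_2,…,h_6`, with `h i` corresponding to `h_{i+2}` and paired with `c i.succ`.) -/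
theorem stmt15 (a₁ a₂ a₃ : Pic7) (ha₁ : IsExc a₁) (ha₂ : IsExc a₂) (ha₃ : IsExc a₃)
    (h12 : a₁ ≠ a₂) (h13 : a₁ ≠ a₃) (h23 : a₂ ≠ a₃) :
    ¬(ip a₁ a₂ = 1 ∧ ip a₁ a₃ = 1 ∧ ip a₂ a₃ = 1) ↔
      ∃ (c : Fin 6 → Pic7) (h : Fin 5 → Pic7),
        (∀ i, IsExc (c i)) ∧ (∀ i, IsExc (h i)) ∧
        Function.Injective c ∧ Function.Injective h ∧
        (∀ i, c i ∉ ({a₁, a₂, a₃} : Set Pic7)) ∧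
        (∀ i, h i ∉ ({a₁, a₂, a₃} : Set Pic7)) ∧
        (∀ i j, i ≠ j → ip (h i) (h j) = 0) ∧
        (∀ i : Fin 5, ip (h i) (c i.succ) = 1 ∧ ip (h i) (c 0) = 1 ∧
          ∀ j : Fin 6, j ≠ 0 → j ≠ i.succ → ip (h i) (c j) = 0) ∧
        (∃ D : Pic7, IsConic D ∧
          { s : Finset Pic7 | s.card = 2 ∧ (∀ x ∈ s, IsExc x) ∧ s.sum id = D } =
            { s | ∃ i : Fin 5, s = {c i.succ, h i} }) := by
  constructor
  · intro hnt
    obtain ⟨i, rfl⟩ := exc_enum a₁ ha₁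
    obtain ⟨j, rfl⟩ := exc_enum a₂ ha₂
    obtain ⟨k, rfl⟩ := exc_enum a₃ ha₃
    rw [TT_iff, TT_iff, TT_iff] at hnt
    obtain ⟨e, he, hei, hej, hek⟩ := triple i j k (by
        rw [Bool.eq_false_iff]; simpa [and_assoc] using hnt)
    simp only [Bool.or_eq_false_iff] at he
    obtain ⟨⟨hi, hj⟩, hk⟩ := he
    have notin : ∀ x, TT e x = true → LL x ∉ ({LL i, LL j, LL k} : Set Pic7) := by
      intro x hx hm
      simp only [Set.mem_insert_iff, Set.mem_singleton_iff] at hm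
      rcases hm with h | h | h <;> have := LL_inj _ _ h <;> subst this <;> simp_all
    refine ⟨fun t => LL (CC e t), fun t => LL (HH e t), fun _ => LL_exc _, fun _ => LL_exc _,
      fun s t h => CC_inj e s t (LL_inj _ _ h), fun s t h => HH_inj e s t (LL_inj _ _ h),
      ?_, fun t => notin _ (HH_T e t), HH_orth e, HC e, -Kcl - LL e, D_conic e, ?_⟩
    · intro t
      refine Fin.cases ?_ (fun t => notin _ (CC_T e t)) t
      simp only [CC_zero]
      intro hm
      simp only [Set.mem_insert_iff, Set.mem_singleton_iff] at hm
      rcases hm with h | h | h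
      · exact hei (LL_inj _ _ h)
      · exact hej (LL_inj _ _ h)
      · exact hek (LL_inj _ _ h)
    · ext s
      simp only [Set.mem_ofPred_eq]
      constructor
      · rintro ⟨hc, hx, hs⟩
        obtain ⟨x, y, hxy, rfl⟩ := Finset.card_eq_two.1 hc
        rw [Finset.sum_pair hxy] at hs
        simp only [id] at hs
        obtain ⟨p, rfl⟩ := exc_enum x (hx x (by simp))
        have hy : y = -Kcl - LL e - LL p := by rw [← hs]; abel
        have hye := hx y (by simp)
        rw [hy] at hye
        obtain ⟨t, ht⟩ := D_fib e p hye
        refine ⟨t, ?_⟩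
        have hst := HC_sum e t
        rcases ht with rfl | rfl
        · have : y = LL (HH e t) := by rw [hy, ← hst]; abel
          rw [this]
        · have : y = LL (CC e t.succ) := by rw [hy, ← hst]; abel
          rw [this, Finset.pair_comm]
      · rintro ⟨t, rfl⟩
        have hne : LL (CC e t.succ) ≠ LL (HH e t) := by
          intro h
          have h1 := (HC e t).1
          rw [h, (LL_exc _).1] at h1
          norm_num at h1
        refine ⟨Finset.card_pair hne, ?_, ?_⟩
        · intro x hx
          simp only [Finset.mem_insert, Finset.mem_singleton] at hx
          rcases hx with rfl | rfl <;> exact LL_exc _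
        · rw [Finset.sum_pair hne]; exact HC_sum e t
  · rintro ⟨c, h, -, -, -, -, hcA, hhA, -, -, D, hD, hset⟩ ⟨t1, t2, t3⟩
    have hE : IsExc (-Kcl - D) := by
      obtain ⟨d1, d2⟩ := hD
      rw [ipK] at d2
      rw [ip_exp] at d1
      refine ⟨?_, ?_⟩
      · rw [ip_exp]; simp [Kcl]; linarith
      · rw [ipK]; simp [Kcl]; linarith
    have main : ∀ a ∈ ({a₁, a₂, a₃} : Set Pic7), IsExc a → ip (-Kcl - D) a = 1 → False := by
      intro a haA ha hea
      have hDa : ip D a = 0 := by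
        have h2 := ha.2
        rw [ipK] at h2
        rw [ip_exp] at hea ⊢
        simp [Kcl] at hea
        linarith
      have hex : IsExc (D - a) := by
        obtain ⟨d1, d2⟩ := hD
        obtain ⟨q1, q2⟩ := ha
        rw [ipK] at d2 q2
        rw [ip_exp] at d1 q1 hDa
        refine ⟨?_, ?_⟩
        · rw [ip_exp]; simp only [Pi.sub_apply]; linarith
        · rw [ipK]; simp only [Pi.sub_apply]; linarith
      have hne : a ≠ D - a := by
        intro hh
        have hD2 : D = a + a := by rw [eq_sub_iff_add_eq] at hh; exact hh.symm
        have q1 := ha.1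
        rw [hD2, ip_exp] at hDa
        rw [ip_exp] at q1
        simp only [Pi.add_apply] at hDa
        linarith
      have hmem : ({a, D - a} : Finset Pic7) ∈
          { s : Finset Pic7 | s.card = 2 ∧ (∀ x ∈ s, IsExc x) ∧ s.sum id = D } := by
        refine ⟨Finset.card_pair hne, ?_, ?_⟩
        · intro x hx
          simp only [Finset.mem_insert, Finset.mem_singleton] at hx
          rcases hx with rfl | rfl
          · exact ha
          · exact hex
        · rw [Finset.sum_pair hne]; simp
      rw [hset] at hmem
      obtain ⟨i, hi⟩ := hmem
      have : a ∈ ({c i.succ, h i} : Finset Pic7) := by rw [← hi]; simp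
      simp only [Finset.mem_insert, Finset.mem_singleton] at this
      rcases this with rfl | rfl
      · exact hcA _ haA
      · exact hhA _ haA
    obtain ⟨e, he⟩ := exc_enum _ hE
    rw [he] at main
    have m1 := main a₁ (by simp) ha₁
    have m2 := main a₂ (by simp) ha₂
    have m3 := main a₃ (by simp) ha₃
    obtain ⟨i, rfl⟩ := exc_enum a₁ ha₁
    obtain ⟨j, rfl⟩ := exc_enum a₂ ha₂
    obtain ⟨k, rfl⟩ := exc_enum a₃ ha₃
    rw [TT_iff] at t1 t2 t3 m1 m2 m3
    have := triangle i j t1 k t2 t3 e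
    simp only [Bool.or_eq_true] at this
    tauto
end

section
/- Let D ∈ ℤ^7 satisfy ⟨D,v⟩ ≥ 0 for every exceptional class v (i.e. D is nef), ⟨D,D⟩ = 1 and ⟨K,D⟩ = −3. Then there exist six pairwise orthogonal exceptional classes g_1,…,g_6 (⟨g_i,g_j⟩ = 0 for i ≠ j) such that 3D = −K + g_1 + … + g_6. (Geometrically: D is the pullback of the class of a line under a presentation of the degree-3 Del Pezzo surface as a blow up of P^2 at 6 points.) -/
open MvPolynomial

instance instDecExc (v : Pic7) : Decidable (IsExc v) := by unfold IsExc; infer_instance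

/-- The 27 exceptional classes. -/
def excList : List Pic7 :=
  (List.finRange 6).map ev ++
  ((List.finRange 6).flatMap fun i => ((List.finRange 6).filter (fun j => i < j)).map fun j =>
    lv - ev i - ev j) ++
  (List.finRange 6).map fun i => (2 : ℤ) • lv + ev i - ∑ j : Fin 6, ev j

/-- Exceptional classes orthogonal to `D`. -/
def orthG (D : Pic7) (i : Fin 6) : Pic7 :=
  (excList.filter fun v => ip D v = 0).getD i 0

/-- The class with multiplicities `a, b, c, d, e, f`. -/
def mkD (n : Fin 6) (a b c d e f : Fin 3) : Pic7 :=
  ![(n.val : ℤ), -(a.val : ℤ), -(b.val : ℤ), -(c.val : ℤ), -(d.val : ℤ), -(e.val : ℤ), -(f.val : ℤ)]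

theorem finite_check : ∀ (n : Fin 6) (a b c d e f : Fin 3),
    a.val + b.val + c.val + d.val + e.val + f.val + 3 = 3 * n.val →
    a.val ^ 2 + b.val ^ 2 + c.val ^ 2 + d.val ^ 2 + e.val ^ 2 + f.val ^ 2 + 1 = n.val ^ 2 →
    (∀ i, IsExc (orthG (mkD n a b c d e f) i)) ∧
      (∀ i j, i ≠ j → ip (orthG (mkD n a b c d e f) i) (orthG (mkD n a b c d e f) j) = 0) ∧
      (3 : ℤ) • (mkD n a b c d e f) = -Kcl + ∑ i : Fin 6, orthG (mkD n a b c d e f) i := by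
  decide +kernel

theorem bound_aux (n a b c d e f : ℤ) (h1 : a + b + c + d + e + f = 3 * n - 3)
    (h2 : a ^ 2 + b ^ 2 + c ^ 2 + d ^ 2 + e ^ 2 + f ^ 2 = n ^ 2 - 1) :
    (1 ≤ n ∧ n ≤ 5) ∧ 0 ≤ a ∧ a ≤ 2 := by
  have hn : (n - 1) * (n - 5) ≤ 0 := by
    have hf : f = 3 * n - 3 - (a + b + c + d + e) := by linarith
    have : (a + b + c + d + e + f) ^ 2 ≤ 6 * (a ^ 2 + b ^ 2 + c ^ 2 + d ^ 2 + e ^ 2 + f ^ 2) := by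
      linarith [sq_nonneg (a - b), sq_nonneg (a - c), sq_nonneg (a - d), sq_nonneg (a - e),
        sq_nonneg (a - f), sq_nonneg (b - c), sq_nonneg (b - d), sq_nonneg (b - e),
        sq_nonneg (b - f), sq_nonneg (c - d), sq_nonneg (c - e), sq_nonneg (c - f),
        sq_nonneg (d - e), sq_nonneg (d - f), sq_nonneg (e - f)]
    rw [h1, h2] at this
    nlinarith
  have hn1 : 1 ≤ n := by by_contra h; nlinarith
  have hn5 : n ≤ 5 := by by_contra h; nlinarith
  refine ⟨⟨hn1, hn5⟩, ?_⟩
  have key : ∀ k : ℤ, (a - k) ^ 2 ≤ n ^ 2 - 1 - 2 * k * (3 * n - 3) + 6 * k ^ 2 := by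
    intro k
    rw [← h1, ← h2]
    linarith [sq_nonneg (b - k), sq_nonneg (c - k), sq_nonneg (d - k), sq_nonneg (e - k),
      sq_nonneg (f - k)]
  have pr : ∀ x : ℤ, 0 ≤ x * (x - 1) := by
    intro x
    rcases le_or_gt x 0 with h | h
    · nlinarith
    · nlinarith
  interval_cases n
  · have := key 0; clear h1 h2 key pr; constructor <;> nlinarith
  · have := pr b; have := pr c; have := pr d; have := pr e; have := pr f
    have : a * (a - 1) ≤ 0 := by linarith
    clear h1 h2 key pr; constructor <;> nlinarith
  · have := key 1; clear h1 h2 key pr; constructor <;> nlinarith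
  · have := pr (b - 1); have := pr (c - 1); have := pr (d - 1); have := pr (e - 1)
    have := pr (f - 1)
    have : (a - 1) * (a - 2) ≤ 0 := by linarith
    clear h1 h2 key pr; constructor <;> nlinarith
  · have := key 2; clear h1 h2 key pr; constructor <;> nlinarith

theorem stmt16 (D : Pic7) (hnef : ∀ v : Pic7, IsExc v → 0 ≤ ip D v)
    (hDD : ip D D = 1) (hKD : ip Kcl D = -3) :
    ∃ g : Fin 6 → Pic7, (∀ i, IsExc (g i)) ∧
      (∀ i j, i ≠ j → ip (g i) (g j) = 0) ∧
      (3 : ℤ) • D = -Kcl + ∑ i : Fin 6, g i := by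
  obtain ⟨n, a, b, c, d, e, f, rfl⟩ : ∃ n a b c d e f : ℤ, D = ![n, -a, -b, -c, -d, -e, -f] := by
    refine ⟨D 0, -D 1, -D 2, -D 3, -D 4, -D 5, -D 6, ?_⟩
    ext i
    fin_cases i <;> simp
  have h2 : a ^ 2 + b ^ 2 + c ^ 2 + d ^ 2 + e ^ 2 + f ^ 2 = n ^ 2 - 1 := by
    have : n * n - (-a * -a + -b * -b + -c * -c + -d * -d + -e * -e + -f * -f) = 1 := by
      rw [← hDD, ip, Fin.sum_univ_six]; rfl
    linarith
  have h1 : a + b + c + d + e + f = 3 * n - 3 := by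
    have : -3 * n - (1 * -a + 1 * -b + 1 * -c + 1 * -d + 1 * -e + 1 * -f) = -3 := by
      rw [ip, Fin.sum_univ_six] at hKD; exact hKD
    linarith
  obtain ⟨⟨n1, n5⟩, a0, a2⟩ := bound_aux n a b c d e f h1 h2
  obtain ⟨-, b0, b2⟩ := bound_aux n b a c d e f (by linarith) (by linarith)
  obtain ⟨-, c0, c2⟩ := bound_aux n c b a d e f (by linarith) (by linarith)
  obtain ⟨-, d0, d2⟩ := bound_aux n d b c a e f (by linarith) (by linarith)
  obtain ⟨-, e0, e2⟩ := bound_aux n e b c d a f (by linarith) (by linarith)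
  obtain ⟨-, f0, f2⟩ := bound_aux n f b c d e a (by linarith) (by linarith)
  clear hDD hKD hnef
  lift n to ℕ using by linarith
  lift a to ℕ using a0
  lift b to ℕ using b0
  lift c to ℕ using c0
  lift d to ℕ using d0
  lift e to ℕ using e0
  lift f to ℕ using f0
  exact ⟨_, finite_check ⟨n, by omega⟩ ⟨a, by omega⟩ ⟨b, by omega⟩ ⟨c, by omega⟩ ⟨d, by omega⟩
    ⟨e, by omega⟩ ⟨f, by omega⟩ (by simp only; omega) (by simp only; zify; linarith)⟩
end

section
/- For every conic class v ∈ ℤ^7 there are exactly 5 unordered pairs {a, b} of distinct exceptional classes with a + b = v. (Every conic bundle on a degree-3 Del Pezzo surface has exactly r − 1 = 5 distinguished global sections.) -/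
open MvPolynomial

def excL : List Pic7 :=
  [![0, 0, 0, 0, 0, 0, 1],
   ![0, 0, 0, 0, 0, 1, 0],
   ![0, 0, 0, 0, 1, 0, 0],
   ![0, 0, 0, 1, 0, 0, 0],
   ![0, 0, 1, 0, 0, 0, 0],
   ![0, 1, 0, 0, 0, 0, 0],
   ![1, -1, -1, 0, 0, 0, 0],
   ![1, -1, 0, -1, 0, 0, 0],
   ![1, -1, 0, 0, -1, 0, 0],
   ![1, -1, 0, 0, 0, -1, 0],
   ![1, -1, 0, 0, 0, 0, -1],
   ![1, 0, -1, -1, 0, 0, 0],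
   ![1, 0, -1, 0, -1, 0, 0],
   ![1, 0, -1, 0, 0, -1, 0],
   ![1, 0, -1, 0, 0, 0, -1],
   ![1, 0, 0, -1, -1, 0, 0],
   ![1, 0, 0, -1, 0, -1, 0],
   ![1, 0, 0, -1, 0, 0, -1],
   ![1, 0, 0, 0, -1, -1, 0],
   ![1, 0, 0, 0, -1, 0, -1],
   ![1, 0, 0, 0, 0, -1, -1],
   ![2, -1, -1, -1, -1, -1, 0],
   ![2, -1, -1, -1, -1, 0, -1],
   ![2, -1, -1, -1, 0, -1, -1],
   ![2, -1, -1, 0, -1, -1, -1],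
   ![2, -1, 0, -1, -1, -1, -1],
   ![2, 0, -1, -1, -1, -1, -1]]

def excF : Finset Pic7 := excL.toFinset

lemma coord_aux (a b c d e f : ℤ) (h : a*a+b*b+c*c+d*d+e*e+f*f = a+b+c+d+e+f) :
    a = 0 ∨ a = 1 := by
  have key : ∀ t : ℤ, 0 ≤ t * t - t := by
    intro t
    rcases le_or_gt t 0 with h | h <;> nlinarith
  have h0 : a * (a - 1) = 0 := by
    nlinarith [key a, key b, key c, key d, key e, key f]
  rcases mul_eq_zero.mp h0 with h | h
  · left; exact h
  · right; omega

lemma coords_aux (a b c d e f : ℤ) (h : a*a+b*b+c*c+d*d+e*e+f*f = a+b+c+d+e+f) :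
    (a = 0 ∨ a = 1) ∧ (b = 0 ∨ b = 1) ∧ (c = 0 ∨ c = 1) ∧ (d = 0 ∨ d = 1) ∧
      (e = 0 ∨ e = 1) ∧ (f = 0 ∨ f = 1) := by
  refine ⟨coord_aux a b c d e f ?_, coord_aux b a c d e f ?_, coord_aux c b a d e f ?_,
    coord_aux d b c a e f ?_, coord_aux e b c d a f ?_, coord_aux f b c d e a ?_⟩ <;> linarith

lemma exc_mem (x : Pic7) (hx : IsExc x) : x ∈ excF := by
  obtain ⟨h1, h2⟩ := hx
  have hx : x = ![x 0, x 1, x 2, x 3, x 4, x 5, x 6] := by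
    funext i; fin_cases i <;> rfl
  have e1 : x 0 * x 0 - (x 1 * x 1 + x 2 * x 2 + x 3 * x 3 + x 4 * x 4 + x 5 * x 5 + x 6 * x 6)
      = -1 := by
    rw [← h1, ip, Fin.sum_univ_six]; rfl
  have e2 : -3 * x 0 - (x 1 + x 2 + x 3 + x 4 + x 5 + x 6) = -1 := by
    rw [← h2, ip, Fin.sum_univ_six]; simp [Kcl]
  rw [hx]
  generalize x 0 = d at *
  generalize x 1 = a1 at *
  generalize x 2 = a2 at *
  generalize x 3 = a3 at *
  generalize x 4 = a4 at *
  generalize x 5 = a5 at *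
  generalize x 6 = a6 at *
  clear h1 h2 hx x
  have hs : a1 + a2 + a3 + a4 + a5 + a6 = 1 - 3 * d := by linarith
  have hc : (1 - 3 * d) ^ 2 ≤ 6 * (d * d + 1) := by
    rw [← hs]
    nlinarith [sq_nonneg (a1 - a2), sq_nonneg (a1 - a3), sq_nonneg (a1 - a4), sq_nonneg (a1 - a5),
      sq_nonneg (a1 - a6), sq_nonneg (a2 - a3), sq_nonneg (a2 - a4), sq_nonneg (a2 - a5),
      sq_nonneg (a2 - a6), sq_nonneg (a3 - a4), sq_nonneg (a3 - a5), sq_nonneg (a3 - a6),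
      sq_nonneg (a4 - a5), sq_nonneg (a4 - a6), sq_nonneg (a5 - a6)]
  have hd0 : 0 ≤ d := by by_contra h; push Not at h; nlinarith
  have hd2 : d ≤ 2 := by by_contra h; push Not at h; nlinarith
  have hd : d = 0 ∨ d = 1 ∨ d = 2 := by omega
  rcases hd with rfl | hd
  · obtain ⟨h1, h2, h3, h4, h5, h6⟩ := coords_aux a1 a2 a3 a4 a5 a6 (by linarith)
    clear e1 hc hd0 hd2 hs
    rcases h1 with rfl | rfl <;> rcases h2 with rfl | rfl <;> rcases h3 with rfl | rfl <;>
    rcases h4 with rfl | rfl <;> rcases h5 with rfl | rfl <;> rcases h6 with rfl | rfl <;>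
    first
    | (exfalso; omega)
    | decide +kernel
  · obtain ⟨h1, h2, h3, h4, h5, h6⟩ := coords_aux (-a1) (-a2) (-a3) (-a4) (-a5) (-a6)
      (by rcases hd with rfl | rfl <;> linarith)
    clear e1 hc hd0 hd2 hs
    have neg1 : ∀ t : ℤ, (-t = 0 ∨ -t = 1) → t = 0 ∨ t = -1 := by intro t; omega
    rcases hd with rfl | rfl <;>
    rcases neg1 _ h1 with rfl | rfl <;> rcases neg1 _ h2 with rfl | rfl <;>
    rcases neg1 _ h3 with rfl | rfl <;> rcases neg1 _ h4 with rfl | rfl <;>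
    rcases neg1 _ h5 with rfl | rfl <;> rcases neg1 _ h6 with rfl | rfl <;>
    first
    | (exfalso; omega)
    | decide +kernel

lemma mem_exc : ∀ x ∈ excF, IsExc x := by
  unfold IsExc
  decide +kernel

lemma conic_exc (v : Pic7) (hv : IsConic v) : IsExc (-Kcl - v) := by
  obtain ⟨h1, h2⟩ := hv
  simp only [ip, Fin.sum_univ_six] at h1 h2
  constructor <;> simp only [ip, Fin.sum_univ_six] <;> simp [Kcl] at * <;> linarith

lemma count : ∀ e ∈ excF,
    ((excF.powersetCard 2).filter (fun s => s.sum id = -Kcl - e)).card = 5 := by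
  decide +kernel

/-- For every conic class `v` there are exactly 5 unordered pairs `{a,b}` of
distinct exceptional classes with `a + b = v`. -/
theorem stmt17 (v : Pic7) (hv : IsConic v) :
    { s : Finset Pic7 | s.card = 2 ∧ (∀ x ∈ s, IsExc x) ∧ s.sum id = v }.ncard = 5 := by
  have h := count _ (exc_mem _ (conic_exc v hv))
  rw [← h, ← Set.ncard_coe_finset]
  congr 1
  ext s
  simp only [Set.mem_ofPred_eq, Finset.coe_filter, Finset.mem_powersetCard, sub_sub_cancel]
  constructor
  · rintro ⟨a, b, c⟩
    exact ⟨⟨fun x hx => exc_mem x (b x hx), a⟩, c⟩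
  · rintro ⟨⟨b, a⟩, c⟩
    exact ⟨a, fun x hx => mem_exc x (b hx), c⟩
end

section
/- The set of exceptional classes in ℤ^7 has exactly 27 elements (the 27 lines on a cubic surface: the six ε_i, the fifteen classes ℓ − ε_i − ε_j for 1 ≤ i < j ≤ 6, and the six classes 2ℓ − Σ_{k≠i} ε_k), and the set of conic classes in ℤ^7 also has exactly 27 elements (the six classes ℓ − ε_i, the fifteen classes 2ℓ − ε_i − ε_j − ε_k − ε_l for distinct i, j, k, l, and the six classes 3ℓ − 2ε_i − Σ_{k≠i} ε_k). -/
open MvPolynomial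

instance (v : Pic7) : Decidable (IsConic v) := by unfold IsConic; infer_instance

/-- An integer vector with coordinates all `p` or all `p + q` according to a boolean vector. -/
def mk (a p q : ℤ) (b : Fin 6 → Bool) : Pic7 := Fin.cons a (fun i => if b i then p + q else p)

/-- The number of `true` entries. -/
def cnt (b : Fin 6 → Bool) : ℤ := ∑ i, if b i then 1 else 0

lemma bool_of_sums (y : Fin 6 → ℤ) (h : ∑ i, y i ^ 2 = ∑ i, y i) :
    ∃ b : Fin 6 → Bool, y = fun i => if b i then 1 else 0 := by
  have h0 : ∑ i, (y i ^ 2 - y i) = 0 := by rw [Finset.sum_sub_distrib, h, sub_self]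
  have hn : ∀ i ∈ Finset.univ, 0 ≤ y i ^ 2 - y i := by
    intro i _
    rcases le_or_gt (y i) 0 with h | h <;> nlinarith
  have h1 := (Finset.sum_eq_zero_iff_of_nonneg hn).1 h0
  refine ⟨fun i => decide (y i = 1), funext fun i => ?_⟩
  have h2 := h1 i (Finset.mem_univ i)
  have h3 : y i * (y i - 1) = 0 := by linarith
  rcases mul_eq_zero.1 h3 with h4 | h4
  · simp [h4]
  · have : y i = 1 := by linarith
    simp [this]

lemma mk_of_sums (v : Pic7) (a p q n : ℤ) (hq : q ^ 2 = 1) (ha : v 0 = a)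
    (h1 : ∑ i : Fin 6, v i.succ = 6 * p + q * n)
    (h2 : ∑ i : Fin 6, v i.succ * v i.succ = 6 * p ^ 2 + 2 * p * q * n + n) :
    ∃ b, cnt b = n ∧ v = mk a p q b := by
  have e1 : ∑ i : Fin 6, q * (v i.succ - p) = n := by
    simp only [Fin.sum_univ_six] at h1 ⊢
    linear_combination q * h1 + n * hq
  have e2 : ∑ i : Fin 6, (q * (v i.succ - p)) ^ 2 = n := by
    have : ∑ i : Fin 6, (q * (v i.succ - p)) ^ 2
        = q ^ 2 * (∑ i : Fin 6, v i.succ * v i.succ - 2 * p * ∑ i : Fin 6, v i.succ + 6 * p ^ 2) := by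
      simp only [Fin.sum_univ_six]; ring
    rw [this, h1, h2, hq]; ring
  obtain ⟨b, hb⟩ := bool_of_sums (fun i => q * (v i.succ - p)) (e2.trans e1.symm)
  refine ⟨b, ?_, ?_⟩
  · rw [← e1]; unfold cnt
    exact Finset.sum_congr rfl fun i _ => (congrFun hb i).symm
  · funext j
    refine Fin.cases ?_ (fun i => ?_) j
    · simp [mk, ha]
    · have h := congrFun hb i
      simp only [mk, Fin.cons_succ] at h ⊢
      have h' : v i.succ = p + q * (if b i then 1 else 0) := by
        rw [← h]; linear_combination (p - v i.succ) * hq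
      rw [h']; split_ifs <;> ring

lemma cs6 (x : Fin 6 → ℤ) : (∑ i, x i) ^ 2 ≤ 6 * ∑ i, x i * x i := by
  have := sq_sum_le_card_mul_sum_sq (s := Finset.univ) (f := x)
  simpa [pow_two] using this

lemma ip_K (v : Pic7) : ip Kcl v = -3 * v 0 - ∑ i : Fin 6, v i.succ := by
  simp [ip, Kcl, Fin.succ_ne_zero]

lemma e0 : ∀ b, cnt b = 1 → ∃ i : Fin 6, mk 0 0 1 b = ev i := by decide +kernel
lemma e1 : ∀ b, cnt b = 2 → ∃ i j : Fin 6, i < j ∧ mk 1 0 (-1) b = lv - ev i - ev j := by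
  decide +kernel
lemma e2 : ∀ b, cnt b = 5 →
    ∃ i : Fin 6, mk 2 0 (-1) b = (2 : ℤ) • lv - (∑ l : Fin 6, ev l) + ev i := by decide +kernel
lemma c1 : ∀ b, cnt b = 1 → ∃ i : Fin 6, mk 1 0 (-1) b = lv - ev i := by decide +kernel
lemma c2 : ∀ b, cnt b = 4 → ∃ i j k l : Fin 6, i ≠ j ∧ i ≠ k ∧ i ≠ l ∧ j ≠ k ∧ j ≠ l ∧ k ≠ l ∧
    mk 2 0 (-1) b = (2 : ℤ) • lv - ev i - ev j - ev k - ev l := by decide +kernel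
lemma c3 : ∀ b, cnt b = 1 →
    ∃ i : Fin 6, mk 3 (-1) (-1) b = (3 : ℤ) • lv - (∑ l : Fin 6, ev l) - ev i := by
  decide +kernel

/-- Boolean vectors with `n` entries `true`. -/
def B (n : ℤ) : Finset (Fin 6 → Bool) := Finset.univ.filter fun b => cnt b = n

/-- The finset of exceptional classes. -/
def Exc27 : Finset Pic7 :=
  (B 1).image (mk 0 0 1) ∪ (B 2).image (mk 1 0 (-1)) ∪ (B 5).image (mk 2 0 (-1))

/-- The finset of conic classes. -/
def Con27 : Finset Pic7 :=
  (B 1).image (mk 1 0 (-1)) ∪ (B 4).image (mk 2 0 (-1)) ∪ (B 1).image (mk 3 (-1) (-1))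

lemma exc_cases (v : Pic7) (h : IsExc v) : (∃ b, cnt b = 1 ∧ v = mk 0 0 1 b) ∨
    (∃ b, cnt b = 2 ∧ v = mk 1 0 (-1) b) ∨ (∃ b, cnt b = 5 ∧ v = mk 2 0 (-1) b) := by
  obtain ⟨h1, h2⟩ := h
  rw [ip_K] at h2
  unfold ip at h1
  have hc := cs6 (fun i => v i.succ)
  have s1 : ∑ i : Fin 6, v i.succ = 1 - 3 * v 0 := by linarith
  have s2 : ∑ i : Fin 6, v i.succ * v i.succ = v 0 * v 0 + 1 := by linarith
  simp only [s1, s2] at hc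
  have l1 : 0 ≤ v 0 := by by_contra hh; nlinarith
  have l2 : v 0 ≤ 2 := by by_contra hh; nlinarith
  have : v 0 = 0 ∨ v 0 = 1 ∨ v 0 = 2 := by omega
  rcases this with h | h | h <;> rw [h] at s1 s2
  · exact Or.inl (mk_of_sums v _ _ _ _ (by norm_num) h (by rw [s1]; norm_num) (by rw [s2]; norm_num))
  · exact Or.inr (Or.inl (mk_of_sums v _ _ _ _ (by norm_num) h (by rw [s1]; norm_num)
      (by rw [s2]; norm_num)))
  · exact Or.inr (Or.inr (mk_of_sums v _ _ _ _ (by norm_num) h (by rw [s1]; norm_num)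
      (by rw [s2]; norm_num)))

lemma conic_cases (v : Pic7) (h : IsConic v) : (∃ b, cnt b = 1 ∧ v = mk 1 0 (-1) b) ∨
    (∃ b, cnt b = 4 ∧ v = mk 2 0 (-1) b) ∨ (∃ b, cnt b = 1 ∧ v = mk 3 (-1) (-1) b) := by
  obtain ⟨h1, h2⟩ := h
  rw [ip_K] at h2
  unfold ip at h1
  have hc := cs6 (fun i => v i.succ)
  have s1 : ∑ i : Fin 6, v i.succ = 2 - 3 * v 0 := by linarith
  have s2 : ∑ i : Fin 6, v i.succ * v i.succ = v 0 * v 0 := by linarith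
  simp only [s1, s2] at hc
  have l1 : 1 ≤ v 0 := by by_contra hh; nlinarith
  have l2 : v 0 ≤ 3 := by by_contra hh; nlinarith
  have : v 0 = 1 ∨ v 0 = 2 ∨ v 0 = 3 := by omega
  rcases this with h | h | h <;> rw [h] at s1 s2
  · exact Or.inl (mk_of_sums v _ _ _ _ (by norm_num) h (by rw [s1]; norm_num) (by rw [s2]; norm_num))
  · exact Or.inr (Or.inl (mk_of_sums v _ _ _ _ (by norm_num) h (by rw [s1]; norm_num)
      (by rw [s2]; norm_num)))
  · exact Or.inr (Or.inr (mk_of_sums v _ _ _ _ (by norm_num) h (by rw [s1]; norm_num)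
      (by rw [s2]; norm_num)))

lemma exc_eq : { v : Pic7 | IsExc v } = (Exc27 : Set Pic7) := by
  ext v
  constructor
  · intro h
    rcases exc_cases v h with ⟨b, hb, rfl⟩ | ⟨b, hb, rfl⟩ | ⟨b, hb, rfl⟩ <;>
      simp only [Exc27, B, Finset.coe_union, Finset.coe_image, Set.mem_union, Set.mem_image,
        Finset.mem_coe, Finset.mem_filter, Finset.mem_univ, true_and]
    · exact Or.inl (Or.inl ⟨b, hb, rfl⟩)
    · exact Or.inl (Or.inr ⟨b, hb, rfl⟩)
    · exact Or.inr ⟨b, hb, rfl⟩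
  · have : ∀ v ∈ Exc27, IsExc v := by decide +kernel
    exact this v

lemma conic_eq : { v : Pic7 | IsConic v } = (Con27 : Set Pic7) := by
  ext v
  constructor
  · intro h
    rcases conic_cases v h with ⟨b, hb, rfl⟩ | ⟨b, hb, rfl⟩ | ⟨b, hb, rfl⟩ <;>
      simp only [Con27, B, Finset.coe_union, Finset.coe_image, Set.mem_union, Set.mem_image,
        Finset.mem_coe, Finset.mem_filter, Finset.mem_univ, true_and]
    · exact Or.inl (Or.inl ⟨b, hb, rfl⟩)
    · exact Or.inl (Or.inr ⟨b, hb, rfl⟩)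
    · exact Or.inr ⟨b, hb, rfl⟩
  · have : ∀ v ∈ Con27, IsConic v := by decide +kernel
    exact this v

lemma r1 : ∀ i : Fin 6, IsExc (ev i) := by decide +kernel
lemma r2 : ∀ i j : Fin 6, i < j → IsExc (lv - ev i - ev j) := by decide +kernel
lemma r3 : ∀ i : Fin 6, IsExc ((2 : ℤ) • lv - (∑ l : Fin 6, ev l) + ev i) := by decide +kernel
lemma t1 : ∀ i : Fin 6, IsConic (lv - ev i) := by decide +kernel
lemma t2 : ∀ i j k l : Fin 6, (i ≠ j ∧ i ≠ k ∧ i ≠ l ∧ j ≠ k ∧ j ≠ l ∧ k ≠ l) →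
    IsConic ((2 : ℤ) • lv - ev i - ev j - ev k - ev l) := by decide +kernel
lemma t3 : ∀ i : Fin 6, IsConic ((3 : ℤ) • lv - (∑ l : Fin 6, ev l) - ev i) := by decide +kernel

/-- The set of exceptional classes consists exactly of the six `ε_i`, the
fifteen `ℓ − ε_i − ε_j` (`i < j`) and the six `2ℓ − Σ_{k≠i} ε_k`, and has 27 elements; the set
of conic classes consists exactly of the six `ℓ − ε_i`, the fifteen `2ℓ − ε_i − ε_j − ε_k − ε_l`
(`i,j,k,l` distinct) and the six `3ℓ − 2ε_i − Σ_{k≠i} ε_k`, and also has 27 elements. -/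
theorem stmt19 :
    { v : Pic7 | IsExc v } =
        ({ v | ∃ i : Fin 6, v = ev i } ∪
          { v | ∃ i j : Fin 6, i < j ∧ v = lv - ev i - ev j } ∪
          { v | ∃ i : Fin 6, v = (2 : ℤ) • lv - (∑ l : Fin 6, ev l) + ev i }) ∧
      { v : Pic7 | IsExc v }.ncard = 27 ∧
      { v : Pic7 | IsConic v } =
        ({ v | ∃ i : Fin 6, v = lv - ev i } ∪
          { v | ∃ i j k l : Fin 6, i ≠ j ∧ i ≠ k ∧ i ≠ l ∧ j ≠ k ∧ j ≠ l ∧ k ≠ l ∧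
            v = (2 : ℤ) • lv - ev i - ev j - ev k - ev l } ∪
          { v | ∃ i : Fin 6, v = (3 : ℤ) • lv - (∑ l : Fin 6, ev l) - ev i }) ∧
      { v : Pic7 | IsConic v }.ncard = 27 := by
  refine ⟨?_, ?_, ?_, ?_⟩
  · ext v
    constructor
    · intro h
      rcases exc_cases v h with ⟨b, hb, rfl⟩ | ⟨b, hb, rfl⟩ | ⟨b, hb, rfl⟩
      · exact Or.inl (Or.inl (e0 b hb))
      · exact Or.inl (Or.inr (e1 b hb))
      · exact Or.inr (e2 b hb)
    · rintro ((⟨i, rfl⟩ | ⟨i, j, hij, rfl⟩) | ⟨i, rfl⟩)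
      · exact r1 i
      · exact r2 i j hij
      · exact r3 i
  · rw [exc_eq, Set.ncard_coe_finset]
    decide +kernel
  · ext v
    constructor
    · intro h
      rcases conic_cases v h with ⟨b, hb, rfl⟩ | ⟨b, hb, rfl⟩ | ⟨b, hb, rfl⟩
      · exact Or.inl (Or.inl (c1 b hb))
      · exact Or.inl (Or.inr (c2 b hb))
      · exact Or.inr (c3 b hb)
    · rintro ((⟨i, rfl⟩ | ⟨i, j, k, l, h1, h2, h3, h4, h5, h6, rfl⟩) | ⟨i, rfl⟩)
      · exact t1 i
      · exact t2 i j k l ⟨h1, h2, h3, h4, h5, h6⟩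
      · exact t3 i
  · rw [conic_eq, Set.ncard_coe_finset]
    decide +kernel
end
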